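/- For every q ∈ [0,1], the distribution π_bal is stationary for Q_bal, i.e., π_bal is a probability distribution on 𝒱 (its entries are nonnegative and sum to 1) and π_bal · Q_bal = π_bal. -/

import Mathlib

/-- Edge type of a state: backward (`b`) or forward (`f`). -/
inductive Edge : Type
  | b | f
deriving DecidableEq

instance : Fintype Edge := ⟨{Edge.b, Edge.f}, fun x => by cases x <;> simp⟩

/-- The 18-element state space `𝒱`: states `A_e^(k)` are encoded as
`Sum.inl (e, k)` and states `B_e^(kℓ)` (with `k ≠ ℓ`) as `Sum.inr (e, ⟨(k, ℓ), _⟩)`. -/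
abbrev St : Type := (Edge × Fin 3) ⊕ (Edge × {kl : Fin 3 × Fin 3 // kl.1 ≠ kl.2})

/-- The element of `{0,1,2}` different from both `k` and `l` (when `k ≠ l`). -/
def third (k l : Fin 3) : Fin 3 :=
  ⟨(6 - (k : ℕ) - (l : ℕ)) % 3, Nat.mod_lt _ (by norm_num)⟩

/-- The transition matrix `Q` with parameters `q₁ = qv 0`, `q₂ = qv 1`, `q₃ = qv 2`
(and `q = qv 0 + qv 1 + qv 2`); all entries not prescribed by the rules are `0`. -/
noncomputable def Qmat (qv : Fin 3 → ℝ) : Matrix St St ℝ :=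
  Matrix.of fun s t =>
    match s, t with
    | Sum.inl (_, k), Sum.inl (Edge.b, j) => if j = k then 0 else qv (third k j)
    | Sum.inl (_, _), Sum.inl (Edge.f, _) => 0
    | Sum.inl (_, k), Sum.inr (Edge.f, kl) =>
        if kl.1.1 = k then (1 - (qv 0 + qv 1 + qv 2)) / 2 else 0
    | Sum.inl (_, k), Sum.inr (Edge.b, kl) => if kl.1.1 = k then qv k / 2 else 0
    | Sum.inr (_, kl), Sum.inl (Edge.b, j) =>
        if j = kl.1.1 then qv (third kl.1.1 kl.1.2) else 0
    | Sum.inr (_, kl), Sum.inl (Edge.f, j) =>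
        if j = third kl.1.1 kl.1.2 then 1 - (qv 0 + qv 1 + qv 2) else 0
    | Sum.inr (_, kl), Sum.inr (Edge.b, kl') =>
        if kl'.1.1 = kl.1.1 ∧ kl'.1.2 = third kl.1.1 kl.1.2 then qv kl.1.1
        else if kl'.1.1 = kl.1.2 ∧ kl'.1.2 = third kl.1.1 kl.1.2 then qv kl.1.2
        else 0
    | Sum.inr _, Sum.inr (Edge.f, _) => 0

/-- The balanced transition matrix `Q_bal`, i.e. `Q` with `q₁ = q₂ = q₃ = q/3`. -/
noncomputable def Qbal (q : ℝ) : Matrix St St ℝ := Qmat fun _ => q / 3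

/-- The distribution `π_bal` on `𝒱`. -/
noncomputable def piBal (q : ℝ) : St → ℝ
  | Sum.inl (Edge.b, _) => q / 6
  | Sum.inl (Edge.f, _) => (1 - q) / 6
  | Sum.inr (Edge.b, _) => q / 12
  | Sum.inr (Edge.f, _) => (1 - q) / 12

theorem sum_edge {M : Type*} [AddCommMonoid M] (g : Edge → M) :
    ∑ e, g e = g Edge.b + g Edge.f := by
  have h : (Finset.univ : Finset Edge) = {Edge.b, Edge.f} := rfl
  rw [h, Finset.sum_pair (by decide)]

theorem sum_offDiag_fin_three {M : Type*} [AddCommMonoid M]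
    (g : {kl : Fin 3 × Fin 3 // kl.1 ≠ kl.2} → M) :
    ∑ x, g x = g ⟨(0, 1), by decide⟩ + (g ⟨(0, 2), by decide⟩ + (g ⟨(1, 0), by decide⟩ +
      (g ⟨(1, 2), by decide⟩ + (g ⟨(2, 0), by decide⟩ + g ⟨(2, 1), by decide⟩)))) := by
  have h : (Finset.univ : Finset {kl : Fin 3 × Fin 3 // kl.1 ≠ kl.2}) =
      {⟨(0, 1), by decide⟩, ⟨(0, 2), by decide⟩, ⟨(1, 0), by decide⟩,
        ⟨(1, 2), by decide⟩, ⟨(2, 0), by decide⟩, ⟨(2, 1), by decide⟩} := by decide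
  rw [h]
  simp [Finset.sum_insert]

/-- For every `q ∈ [0,1]`, `π_bal` is a probability distribution on `𝒱`
and `π_bal · Q_bal = π_bal`. -/
theorem stmt9 (q : ℝ) (hq0 : 0 ≤ q) (hq1 : q ≤ 1) :
    (∀ V : St, 0 ≤ piBal q V) ∧ (∑ V : St, piBal q V = 1) ∧
      ∀ V' : St, ∑ V : St, piBal q V * Qbal q V V' = piBal q V' := by
  refine ⟨?_, ?_, ?_⟩
  · rintro (⟨_ | _, _⟩ | ⟨_ | _, _⟩) <;> simp only [piBal] <;> linarith
  · simp only [Fintype.sum_sum_type, Fintype.sum_prod_type, sum_edge, sum_offDiag_fin_three,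
      Fin.sum_univ_three, piBal]
    ring
  · rintro (⟨_ | _, k⟩ | ⟨_ | _, ⟨⟨k, l⟩, hkl⟩⟩) <;>
      simp only [Fintype.sum_sum_type, Fintype.sum_prod_type, sum_edge, sum_offDiag_fin_three,
        Fin.sum_univ_three, piBal, Qbal, Qmat, Matrix.of_apply]
    · fin_cases k <;> simp <;> ring
    · fin_cases k <;> simp [third] <;> ring
    · fin_cases k <;> fin_cases l <;> first | exact absurd rfl hkl | (simp [third]; ring)
    · fin_cases k <;> fin_cases l <;> first | exact absurd rfl hkl | (simp; ring)
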